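/- For all r ∈ (0,1), (3/5)·2^{−14} < (S_{5/2,2}(1, √(1−r²)) − (2/π)E(r)) / r⁸ < 16/25 − 2/π, where E is the complete elliptic integral of the second kind and S_{5/2,2}(1,x) = ((4/5)(1−x^{5/2})/(1−x²))². -/

import Mathlib

open Real

/-- Complete elliptic integral of the second kind. -/
noncomputable def ellipticE (r : ℝ) : ℝ :=
  ∫ t in (0:ℝ)..(π / 2), Real.sqrt (1 - r ^ 2 * Real.sin t ^ 2)

/-- The Stolarsky mean `S_{5/2,2}(1,x)`. -/
noncomputable def S52 (x : ℝ) : ℝ := (4 / 5 * (1 - x ^ ((5:ℝ) / 2)) / (1 - x ^ 2)) ^ 2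

/-- The coefficients `(-1)ⁿ (a choose n)` of the Taylor series of `(1 - u) ^ a`. -/
noncomputable def altChoose (a : ℝ) (n : ℕ) : ℝ :=
  ∏ i ∈ Finset.range n, ((i - a) / (i + 1))

/-- The mean value of `sin ^ (2 * n)`. -/
noncomputable def sinMean (n : ℕ) : ℝ :=
  ∏ i ∈ Finset.range n, ((2 * i + 1 : ℝ) / (2 * i + 2))

/-- The Taylor coefficients of `S52 √(1 - u) - 2 / π * ellipticE √u`. -/
noncomputable def diffCoeff (n : ℕ) : ℝ :=
  16 / 25 * (altChoose (5 / 2) (n + 2) - 2 * altChoose (5 / 4) (n + 2))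
    - altChoose (1 / 2) n * sinMean n

lemma altChoose_succ (a : ℝ) (n : ℕ) :
    altChoose a (n + 1) = altChoose a n * ((n - a) / (n + 1)) :=
  Finset.prod_range_succ _ _

lemma sinMean_succ (n : ℕ) : sinMean (n + 1) = sinMean n * ((2 * n + 1) / (2 * n + 2)) :=
  Finset.prod_range_succ _ _

lemma altChoose_eq (a : ℝ) (n : ℕ) : altChoose a n = (-1) ^ n * Ring.choose a n := by
  have key : ∀ n : ℕ, (n.factorial : ℝ) * Ring.choose a n = (descPochhammer ℤ n).smeval a := by
    intro n
    rw [Ring.descPochhammer_eq_factorial_smul_choose, nsmul_eq_mul]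
  induction n with
  | zero => simp [altChoose]
  | succ n ih =>
    have h1 := key (n + 1)
    rw [descPochhammer_succ_right, Polynomial.smeval_mul, ← key n, Nat.factorial_succ] at h1
    have hf : (n.factorial : ℝ) ≠ 0 := by positivity
    have h2 : ((n : ℝ) + 1) * Ring.choose a (n + 1) = Ring.choose a n * (a - n) := by
      apply mul_left_cancel₀ hf
      simp [Polynomial.smeval_natCast] at h1
      linarith
    rw [altChoose_succ, ih, ← mul_div_assoc, div_eq_iff (by positivity), pow_succ]
    linear_combination (-1) ^ n * h2

lemma hasSum_one_sub_rpow (a : ℝ) {u : ℝ} (h0 : 0 ≤ u) (h1 : u < 1) :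
    HasSum (fun n ↦ altChoose a n * u ^ n) ((1 - u) ^ a) := by
  have h := (Real.one_add_rpow_hasFPowerSeriesOnBall_zero (a := a)).hasSum (y := -u) (by
    rw [← ENNReal.ofReal_one, Metric.eball_ofReal]
    simpa [abs_of_nonneg h0] using h1)
  simp only [binomialSeries_apply, zero_add] at h
  convert! h using 2 with n
  rw [altChoose_eq, List.ofFn_const, List.prod_replicate, smul_eq_mul, neg_pow u]
  ring

lemma two_div_pi_mul_integral_sin_pow (n : ℕ) :
    2 / π * ∫ t in (0 : ℝ)..(π / 2), sin t ^ (2 * n) = sinMean n := by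
  induction n with
  | zero =>
    simp [sinMean]
  | succ n ih =>
    rw [mul_add, mul_one, integral_sin_pow, sinMean_succ, ← ih]
    simp
    ring

lemma hasSum_ellipticE {r : ℝ} (hr : r ∈ Set.Ioo (0 : ℝ) 1) :
    HasSum (fun n ↦ altChoose (1 / 2) n * sinMean n * (r ^ 2) ^ n) (2 / π * ellipticE r) := by
  have hu : r ^ 2 < 1 := by nlinarith [hr.1, hr.2]
  have hu0 : 0 ≤ r ^ 2 := sq_nonneg r
  have hs : Summable fun n ↦ |altChoose (1 / 2) n * (r ^ 2) ^ n| :=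
    (hasSum_one_sub_rpow (1 / 2) hu0 hu).summable.abs
  have h := intervalIntegral.hasSum_integral_of_dominated_convergence
    (μ := MeasureTheory.volume) (a := 0) (b := π / 2)
    (F := fun n t ↦ altChoose (1 / 2) n * (r ^ 2) ^ n * sin t ^ (2 * n))
    (f := fun t ↦ √(1 - r ^ 2 * sin t ^ 2))
    (fun n _ ↦ |altChoose (1 / 2) n * (r ^ 2) ^ n|)
    (fun n ↦ (by fun_prop : Continuous _).aestronglyMeasurable)
    (fun n ↦ .of_forall fun t _ ↦ by
      rw [norm_mul, norm_eq_abs, norm_pow, norm_eq_abs]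
      exact mul_le_of_le_one_right (abs_nonneg _) (pow_le_one₀ (abs_nonneg _) (abs_sin_le_one t)))
    (.of_forall fun t _ ↦ hs) (by simp)
    (.of_forall fun t _ ↦ by
      have hsin : sin t ^ 2 ≤ 1 := sin_sq_le_one t
      have := hasSum_one_sub_rpow (1 / 2) (u := r ^ 2 * sin t ^ 2) (by positivity)
        (by nlinarith [sq_nonneg (sin t)])
      rw [← sqrt_eq_rpow] at this
      convert! this using 2 with n
      rw [mul_pow, pow_mul (sin t), mul_assoc])
  convert! h.mul_left (2 / π) using 2 with n
  rw [intervalIntegral.integral_const_mul, ← two_div_pi_mul_integral_sin_pow]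
  ring

lemma S52_sqrt {u : ℝ} (h1 : u ≤ 1) :
    S52 √(1 - u) = (4 / 5 * (1 - (1 - u) ^ (5 / 4 : ℝ)) / u) ^ 2 := by
  have h : 0 ≤ 1 - u := by linarith
  rw [S52, sq_sqrt h, sqrt_eq_rpow, ← rpow_mul h]
  norm_num

lemma hasSum_S52 {u : ℝ} (h0 : 0 < u) (h1 : u < 1) :
    HasSum (fun n ↦ 16 / 25 * (altChoose (5 / 2) (n + 2) - 2 * altChoose (5 / 4) (n + 2)) * u ^ n)
      (S52 √(1 - u)) := by
  have h := (hasSum_nat_add_iff' 2).mpr <|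
    (hasSum_one_sub_rpow (5 / 2) h0.le h1).sub ((hasSum_one_sub_rpow (5 / 4) h0.le h1).mul_left 2)
  convert! h.mul_left (16 / 25 / u ^ 2) using 1
  · ext n
    field_simp
    ring
  · rw [S52_sqrt h1.le]
    have : (1 - u) ^ (5 / 2 : ℝ) = ((1 - u) ^ (5 / 4 : ℝ)) ^ 2 := by
      rw [← rpow_natCast, ← rpow_mul (by linarith)]
      norm_num
    rw [this]
    simp [altChoose, Finset.sum_range_succ]
    field_simp
    ring

lemma diffCoeff_eq_zero {n : ℕ} (hn : n < 4) : diffCoeff n = 0 := by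
  interval_cases n <;> norm_num [diffCoeff, altChoose, sinMean, Finset.prod_range_succ]

lemma diffCoeff_four : diffCoeff 4 = 3 / 5 * 2 ^ (-(14 : ℤ)) := by
  norm_num [diffCoeff, altChoose, sinMean, Finset.prod_range_succ]

lemma diffCoeff_pos_of_twelve_le {n : ℕ} (hn : 12 ≤ n) : 0 < diffCoeff n := by
  suffices H : 0 ≤ altChoose (5 / 4) (n + 2) ∧ altChoose (5 / 2) (n + 2) ≤ 0 ∧
      0 ≤ -(altChoose (1 / 2) n * sinMean n) ∧ 0 < diffCoeff n from H.2.2.2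
  induction n, hn using Nat.le_induction with
  | base => norm_num [diffCoeff, altChoose, sinMean, Finset.prod_range_succ]
  | succ n hn ih =>
    have hn' : (12 : ℝ) ≤ n := by exact_mod_cast hn
    rw [diffCoeff] at ih ⊢
    rw [show n + 1 + 2 = n + 2 + 1 by ring, altChoose_succ _ (n + 2), altChoose_succ _ (n + 2),
      altChoose_succ _ n, sinMean_succ]
    push_cast
    generalize altChoose (5 / 4) (n + 2) = A at ih ⊢
    generalize altChoose (5 / 2) (n + 2) = B at ih ⊢
    rw [mul_mul_mul_comm]
    generalize altChoose (1 / 2) n * sinMean n = e at ih ⊢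
    generalize (n : ℝ) = x at hn' ⊢
    obtain ⟨hA, hB, he, h⟩ := ih
    have h54 : 0 < (x + 2 - 5 / 4) / (x + 2 + 1) := div_pos (by linarith) (by linarith)
    have h52 : 0 ≤ (x + 2 - 5 / 2) / (x + 2 + 1) := div_nonneg (by linarith) (by linarith)
    have hle : (x + 2 - 5 / 2) / (x + 2 + 1) ≤ (x + 2 - 5 / 4) / (x + 2 + 1) := by
      gcongr; norm_num
    have hle' : (x + 2 - 5 / 4) / (x + 2 + 1) ≤
        (x - 1 / 2) / (x + 1) * ((2 * x + 1) / (2 * x + 2)) := by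
      rw [div_mul_div_comm, div_le_div_iff₀ (by linarith) (by nlinarith)]
      nlinarith [mul_nonneg (sub_nonneg.mpr hn') (sub_nonneg.mpr hn')]
    generalize (x + 2 - 5 / 4) / (x + 2 + 1) = p at *
    generalize (x + 2 - 5 / 2) / (x + 2 + 1) = q at *
    generalize (x - 1 / 2) / (x + 1) * ((2 * x + 1) / (2 * x + 2)) = s at *
    refine ⟨by positivity, mul_nonpos_of_nonpos_of_nonneg hB h52, ?_, ?_⟩
    · rw [← neg_mul]
      exact mul_nonneg he (by linarith)
    · linarith [mul_pos h h54, mul_nonneg (neg_nonneg.mpr hB) (sub_nonneg.mpr hle),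
        mul_nonneg he (sub_nonneg.mpr hle')]

lemma diffCoeff_pos {n : ℕ} (hn : 4 ≤ n) : 0 < diffCoeff n := by
  rcases le_or_gt 12 n with h | h
  · exact diffCoeff_pos_of_twelve_le h
  · interval_cases n <;> norm_num [diffCoeff, altChoose, sinMean, Finset.prod_range_succ]

lemma hasSum_S52_sub_ellipticE_div {r : ℝ} (hr : r ∈ Set.Ioo (0 : ℝ) 1) :
    HasSum (fun n ↦ diffCoeff (n + 4) * (r ^ 2) ^ n)
      ((S52 √(1 - r ^ 2) - 2 / π * ellipticE r) / r ^ 8) := by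
  have h0 : 0 < r := hr.1
  have hu : r ^ 2 < 1 := by nlinarith [hr.1, hr.2]
  have h := (hasSum_nat_add_iff' 4).mpr
    ((hasSum_S52 (pow_pos h0 2) hu).sub (hasSum_ellipticE hr))
  simp only [← sub_mul] at h
  change HasSum (fun n ↦ diffCoeff (n + 4) * (r ^ 2) ^ (n + 4))
    (_ - ∑ i ∈ Finset.range 4, diffCoeff i * (r ^ 2) ^ i) at h
  rw [Finset.sum_eq_zero (fun i hi ↦ by
    rw [diffCoeff_eq_zero (Finset.mem_range.mp hi), zero_mul]), sub_zero] at h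
  convert! h.div_const (r ^ 8) using 2 with n
  field_simp
  ring

lemma strictMonoOn_S52_sub_ellipticE_div :
    StrictMonoOn (fun r ↦ (S52 √(1 - r ^ 2) - 2 / π * ellipticE r) / r ^ 8)
      (Set.Ioo (0 : ℝ) 1) := by
  intro r hr s hs hrs
  have hr0 := hr.1
  have hlt : r ^ 2 < s ^ 2 := by gcongr
  refine hasSum_lt (i := 1) (fun n ↦ ?_) ?_ (hasSum_S52_sub_ellipticE_div hr)
    (hasSum_S52_sub_ellipticE_div hs)
  · have := diffCoeff_pos (n := n + 4) (by omega)
    dsimp only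
    gcongr
  · have := diffCoeff_pos (n := 1 + 4) (by omega)
    simpa using mul_lt_mul_of_pos_left hlt this

lemma continuous_ellipticE : Continuous ellipticE := by
  unfold ellipticE
  exact intervalIntegral.continuous_parametric_intervalIntegral_of_continuous' (by fun_prop) _ _

lemma ellipticE_one : ellipticE 1 = 1 := by
  rw [ellipticE, intervalIntegral.integral_congr (g := cos), integral_cos]
  · simp
  · intro t ht
    rw [Set.uIcc_of_le (by positivity)] at ht
    have : 0 ≤ cos t := cos_nonneg_of_mem_Icc ⟨by linarith [ht.1, pi_pos], ht.2⟩
    dsimp only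
    rw [one_pow, one_mul, ← cos_sq', sqrt_sq this]

lemma continuousAt_S52_sub_ellipticE_div :
    ContinuousAt (fun r ↦ (S52 √(1 - r ^ 2) - 2 / π * ellipticE r) / r ^ 8) 1 := by
  have hE := continuous_ellipticE.continuousAt (x := 1)
  have hp : Continuous fun x : ℝ ↦ x ^ (5 / 2 : ℝ) := continuous_rpow_const (by norm_num)
  have hS : ContinuousAt (fun r : ℝ ↦ S52 √(1 - r ^ 2)) 1 := by
    unfold S52
    refine (ContinuousAt.div ?_ (by fun_prop) (by simp)).pow 2
    exact ((continuous_const.sub (hp.comp (by fun_prop))).const_smul (4 / 5 : ℝ)).continuousAt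
  exact (hS.sub (hE.const_mul _)).div (by fun_prop) (by simp)

theorem S52_sub_ellipticE_div_r8_bounds (r : ℝ) (hr : r ∈ Set.Ioo (0:ℝ) 1) :
    3 / 5 * 2 ^ (-(14:ℤ)) <
      (S52 (Real.sqrt (1 - r ^ 2)) - 2 / π * ellipticE r) / r ^ 8 ∧
    (S52 (Real.sqrt (1 - r ^ 2)) - 2 / π * ellipticE r) / r ^ 8 < 16 / 25 - 2 / π := by
  constructor
  · have hr0 := hr.1
    have h := hasSum_S52_sub_ellipticE_div hr
    have hle := sum_le_hasSum (Finset.range 2) (fun n _ ↦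
      mul_nonneg (diffCoeff_pos (n := n + 4) (by omega)).le (by positivity)) h
    have h5 : 0 < diffCoeff 5 * r ^ 2 := mul_pos (diffCoeff_pos (by norm_num)) (by positivity)
    simp only [Finset.sum_range_succ, Finset.sum_range_zero] at hle
    norm_num only [pow_zero, pow_one, mul_one, zero_add, diffCoeff_four] at hle ⊢
    linarith
  · obtain ⟨s, hrs, hs1⟩ := exists_between hr.2
    have hs : s ∈ Set.Ioo (0 : ℝ) 1 := ⟨hr.1.trans hrs, hs1⟩
    refine (strictMonoOn_S52_sub_ellipticE_div hr hs hrs).trans_le ?_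
    have hlim := continuousAt_S52_sub_ellipticE_div.tendsto.mono_left
      (nhdsWithin_le_nhds (s := Set.Iio 1))
    have hval : (S52 √(1 - 1 ^ 2) - 2 / π * ellipticE 1) / 1 ^ 8 = 16 / 25 - 2 / π := by
      rw [ellipticE_one, S52]
      norm_num
    rw [hval] at hlim
    refine ge_of_tendsto hlim ?_
    filter_upwards [Ioo_mem_nhdsLT hs1] with t ht
    exact (strictMonoOn_S52_sub_ellipticE_div hs ⟨hs.1.trans ht.1, ht.2⟩ ht.1).le
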